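/- arXiv:1306.0828 — 4 statements merged into one kernel-verified Lean document; each statement's English description precedes it below -/
import Mathlib

section
/- Fix k ≥ 1. The partially ordered set (𝓜, ≼) is a well-partial-order. -/
/-- An element of the set 𝓜: a natural number `len` (the length), a matrix `A` with `k+1`
rows and `len` columns of natural numbers, and a degree `d`, such that every column sum of
`A` equals `d` and each of the first `k` row sums of `A` is at most `d`. -/
structure MatM (k : ℕ) where
  len : ℕ
  A : Fin (k + 1) → Fin len → ℕ
  d : ℕ
  colsum : ∀ j, ∑ i, A i j = d
  rowsum : ∀ i : Fin k, ∑ j, A i.castSucc j ≤ d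

/-- The partial order ≼ on 𝓜: `X ≼ Y` iff `d_X ≤ d_Y` and there is a strictly increasing
map `ρ` of column indices with `ρX ≤ Y` entrywise, where `ρX` has column `X_{·,j}` at
position `ρ(j)` and the trivial column `(0,…,0,d_X)ᵀ` at positions outside the image of `ρ`. -/
def MatM.pre {k : ℕ} (X Y : MatM k) : Prop :=
  X.d ≤ Y.d ∧ ∃ ρ : Fin X.len → Fin Y.len, StrictMono ρ ∧
    (∀ i j, X.A i j ≤ Y.A i (ρ j)) ∧
    (∀ j : Fin Y.len, (∀ j', ρ j' ≠ j) → X.d ≤ Y.A (Fin.last k) j)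

/-- Higman's lemma for finite words presented as functions on `Fin`. -/
theorem exists_strictMono_le_comp {α : Type*} [Preorder α] [WellQuasiOrderedLE α]
    (len : ℕ → ℕ) (w : ∀ n, Fin (len n) → α) :
    ∃ i j : ℕ, i < j ∧ ∃ ρ : Fin (len i) → Fin (len j), StrictMono ρ ∧
      ∀ a, w i a ≤ w j (ρ a) := by
  have hpwo := Set.PartiallyWellOrderedOn.partiallyWellOrderedOn_sublistForall₂ (· ≤ ·)
    (Set.isPWO_of_wellQuasiOrderedLE (Set.univ : Set α))
  obtain ⟨i, j, hij, h⟩ :=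
    hpwo.exists_lt (f := fun n => List.ofFn (w n)) fun _ _ _ => Set.mem_univ _
  obtain ⟨l, hl, hsub⟩ := List.sublistForall₂_iff.1 h
  obtain ⟨e, he⟩ := List.sublist_iff_exists_fin_orderEmbedding_get_eq.1 hsub
  obtain ⟨hlen, hle⟩ := List.forall₂_iff_get.1 hl
  have h₁ : len i = l.length := by simpa using hlen
  have h₂ : (List.ofFn (w j)).length = len j := by simp
  refine ⟨i, j, hij, fun a => (e (a.cast h₁)).cast h₂, fun a b hab => ?_, fun a => ?_⟩
  · exact e.strictMono (show a.cast h₁ < b.cast h₁ from hab)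
  · have := hle a (by simp) (h₁ ▸ a.2)
    have hea := he (a.cast h₁)
    simp only [List.get_eq_getElem, List.getElem_ofFn, Fin.val_cast] at this hea
    rw [hea] at this
    exact this

/-- A bounded sequence of natural numbers has a constant subsequence. -/
theorem exists_constant_subseq_of_le {u : ℕ → ℕ} {B : ℕ} (hu : ∀ n, u n ≤ B) :
    ∃ g : ℕ ↪o ℕ, ∀ m n, m < n → u (g m) = u (g n) := by
  obtain ⟨g, hg | hg⟩ := exists_increasing_or_nonincreasing_subseq (· = ·) u
  · exact ⟨g, hg⟩
  · have hinj : Function.Injective (u ∘ g) := fun m n hmn => by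
      rcases lt_trichotomy m n with h | h | h
      · exact absurd hmn (hg m n h)
      · exact h
      · exact absurd hmn.symm (hg n m h)
    exact absurd ((Set.finite_Iic B).subset (Set.range_subset_iff.2 fun n => hu (g n)))
      (Set.infinite_range_of_injective hinj)

namespace MatM

variable {k : ℕ}

/-- The columns whose last entry is smaller than `t`. -/
def heavy (X : MatM k) (t : ℕ) : Finset (Fin X.len) :=
  {j | X.A (Fin.last k) j < t}

theorem mem_heavy {X : MatM k} {t : ℕ} {j : Fin X.len} :
    j ∈ X.heavy t ↔ X.A (Fin.last k) j < t := by
  simp [heavy]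

theorem sum_upper_add_last (X : MatM k) (j : Fin X.len) :
    ∑ i : Fin k, X.A i.castSucc j + X.A (Fin.last k) j = X.d := by
  rw [← Fin.sum_univ_castSucc (fun i => X.A i j), X.colsum]

theorem card_heavy_mul_le (X : MatM k) (t : ℕ) :
    (X.heavy t).card * (X.d + 1 - t) ≤ k * X.d := by
  calc (X.heavy t).card * (X.d + 1 - t)
      ≤ ∑ j ∈ X.heavy t, ∑ i : Fin k, X.A i.castSucc j := by
        rw [← smul_eq_mul]
        refine Finset.card_nsmul_le_sum _ _ _ fun j hj => ?_
        have := X.sum_upper_add_last j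
        have := mem_heavy.1 hj
        omega
    _ ≤ ∑ j, ∑ i : Fin k, X.A i.castSucc j :=
        Finset.sum_le_univ_sum_of_nonneg fun _ => Nat.zero_le _
    _ = ∑ i : Fin k, ∑ j, X.A i.castSucc j := Finset.sum_comm
    _ ≤ ∑ _i : Fin k, X.d := Finset.sum_le_sum fun i _ => X.rowsum i
    _ = k * X.d := by simp

/-- If the numbers of heavy columns agree, a strictly increasing map sending heavy columns to
heavy columns hits every heavy column. -/
theorem pre_of_card_heavy_eq {X Y : MatM k} {s t : ℕ} (hd : X.d ≤ Y.d) (ht : X.d ≤ t)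
    (hcard : (X.heavy s).card = (Y.heavy t).card) {ρ : Fin X.len → Fin Y.len}
    (hρ : StrictMono ρ) (hle : ∀ i j, X.A i j ≤ Y.A i (ρ j))
    (hheavy : ∀ j ∈ X.heavy s, ρ j ∈ Y.heavy t) : X.pre Y := by
  refine ⟨hd, ρ, hρ, hle, fun j hj => ht.trans ?_⟩
  by_contra! hlt
  obtain ⟨j', -, rfl⟩ := Finset.surjOn_of_injOn_of_card_le ρ hheavy hρ.injective.injOn hcard.ge
    (mem_heavy.2 hlt)
  exact hj j' rfl

theorem exists_pre_of_card_heavy_le (f : ℕ → MatM k) (t : ℕ → ℕ) (B : ℕ)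
    (hB : ∀ n, ((f n).heavy (t n)).card ≤ B)
    (hf : ∀ m n, m < n → (f m).d ≤ (f n).d ∧ (f m).d ≤ t n) :
    ∃ i j : ℕ, i < j ∧ (f i).pre (f j) := by
  obtain ⟨g, hg⟩ := exists_constant_subseq_of_le hB
  obtain ⟨i, j, hij, ρ, hρ, hle⟩ := exists_strictMono_le_comp (fun n => (f (g n)).len)
    fun n a => ((a ∈ (f (g n)).heavy (t (g n)) : Prop), fun i => (f (g n)).A i a)
  have hg' : g i < g j := g.strictMono hij
  exact ⟨g i, g j, hg', pre_of_card_heavy_eq (hf _ _ hg').1 (hf _ _ hg').2 (hg i j hij) hρ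
    (fun r a => (hle a).2 r) fun a => (hle a).1⟩

end MatM

/-- (𝓜, ≼) is a well-partial-order: every infinite sequence in 𝓜 contains indices
`i < j` with the `i`-th term ≼ the `j`-th term. -/
theorem matM_wpo (k : ℕ) (hk : 1 ≤ k) (f : ℕ → MatM k) :
    ∃ i j : ℕ, i < j ∧ MatM.pre (f i) (f j) := by
  have : IsTrans ℕ fun a b => 2 * a + 1 ≤ b := ⟨fun _ _ _ _ _ => by omega⟩
  suffices h : ∃ g : ℕ ↪o ℕ, ∃ i j : ℕ, i < j ∧ (f (g i)).pre (f (g j)) by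
    obtain ⟨g, i, j, hij, h⟩ := h
    exact ⟨g i, g j, g.strictMono hij, h⟩
  obtain ⟨g, hg | hg⟩ :=
    exists_increasing_or_nonincreasing_subseq (fun a b => 2 * a + 1 ≤ b) fun n => (f n).d
  · refine ⟨g, MatM.exists_pre_of_card_heavy_le (fun n => f (g n)) (fun n => (f (g n)).d / 2)
      (2 * k) (fun n => ?_) fun m n hmn => ?_⟩
    · have h := (f (g n)).card_heavy_mul_le ((f (g n)).d / 2)
      have hpos : 0 < (f (g n)).d + 1 := by omega
      refine Nat.le_of_mul_le_mul_right ?_ hpos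
      have : (f (g n)).d + 1 ≤ 2 * ((f (g n)).d + 1 - (f (g n)).d / 2) := by omega
      nlinarith [Nat.mul_le_mul_left ((f (g n)).heavy ((f (g n)).d / 2)).card this]
    · have := hg m n hmn
      omega
  · obtain ⟨c, hc⟩ := exists_constant_subseq_of_le (u := fun n => (f (g (n + 1))).d)
      (B := 2 * (f (g 0)).d) fun n => by
        have := hg 0 (n + 1) n.succ_pos
        omega
    have hd : ∀ n, (f (g (c n + 1))).d ≤ 2 * (f (g 0)).d := fun n => by
      have := hg 0 (c n + 1) (c n).succ_pos
      omega
    obtain ⟨i, j, hij, h⟩ := MatM.exists_pre_of_card_heavy_le (fun n => f (g (c n + 1)))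
      (fun n => (f (g (c n + 1))).d) (k * (2 * (f (g 0)).d))
      (fun n => by
        have h := (f (g (c n + 1))).card_heavy_mul_le (f (g (c n + 1))).d
        rw [Nat.add_sub_cancel_left, mul_one] at h
        exact h.trans (Nat.mul_le_mul_left k (hd n)))
      fun m n hmn => ⟨(hc m n hmn).le, (hc m n hmn).le⟩
    exact ⟨g, c i + 1, c j + 1, Nat.succ_lt_succ (c.strictMono hij), h⟩
end

section
/- Fix k ≥ 1. The Inc(ℕ)-divisibility order ≼ on the set G of good matrices in ℕ^{[k]×ℕ} is a well-partial-order. -/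
/-- `A ∈ ℕ^{[k]×ℕ}` is good of degree `d`: it has finitely many nonzero entries, all row
sums equal `d`, and every column sum is at most `d`. -/
def IsGood {k : ℕ} (A : Fin k → ℕ → ℕ) (d : ℕ) : Prop :=
  {q : Fin k × ℕ | A q.1 q.2 ≠ 0}.Finite ∧
    (∀ i, ∑ᶠ j, A i j = d) ∧ ∀ j, (∑ i, A i j) ≤ d

/-- The action of a map `π : ℕ → ℕ` on matrices by moving columns: `colShift π A` has
column `A_{·,j}` at position `π(j)` for every `j`, and zero columns at positions outside
the image of `π`. -/
noncomputable def colShift {k : ℕ} (π : ℕ → ℕ) (A : Fin k → ℕ → ℕ) : Fin k → ℕ → ℕ :=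
  fun i => Function.extend π (A i) (fun _ => 0)

/-- The Inc(ℕ)-divisibility order on good matrices: `A ≼ B` iff there is a strictly
increasing `π : ℕ → ℕ` such that `B − πA` is entrywise nonnegative and good. -/
def IncDiv {k : ℕ} (A B : Fin k → ℕ → ℕ) : Prop :=
  ∃ π : ℕ → ℕ, StrictMono π ∧ (∀ i j, colShift π A i j ≤ B i j) ∧
    ∃ d : ℕ, IsGood (fun i j => B i j - colShift π A i j) d

/-- **Higman's lemma** for sequences of letters read up to cut-off positions `N n`: some word
embeds into a later one by a strictly increasing map that also respects the cut-offs. -/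
theorem WellQuasiOrdered.exists_strictMono_word {α : Type*} {r : α → α → Prop} [IsPreorder α r]
    (hr : WellQuasiOrdered r) (u : ℕ → ℕ → α) (N : ℕ → ℕ) :
    ∃ m n : ℕ, m < n ∧ ∃ π : ℕ → ℕ, StrictMono π ∧
      (∀ j < N m, r (u m j) (u n (π j))) ∧ ∀ j, N m ≤ j → N n ≤ π j := by
  have hpwo := Set.PartiallyWellOrderedOn.partiallyWellOrderedOn_sublistForall₂ r
    (Set.partiallyWellOrderedOn_univ_iff.2 hr)
  obtain ⟨m, n, hmn, h⟩ := hpwo (fun n => ⟨(List.range (N n)).map (u n), fun _ _ => Set.mem_univ _⟩)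
  refine ⟨m, n, hmn, ?_⟩
  obtain ⟨l, hl, hsub⟩ := List.sublistForall₂_iff.1 h
  obtain ⟨f, hf⟩ := List.sublist_iff_exists_orderEmbedding_getElem?_eq.1 hsub
  have hlen : l.length = N m := by simpa using hl.length_eq.symm
  refine ⟨f, f.strictMono, fun j hj => ?_, fun j hj => ?_⟩
  · have hfj := hf j
    rw [List.getElem?_eq_getElem (by omega), eq_comm, List.getElem?_eq_some_iff] at hfj
    obtain ⟨h₁, h₂⟩ := hfj
    have := hl.get (i := j) (by simpa using hj) (by omega)
    simp only [List.get_eq_getElem] at this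
    rw [← h₂] at this
    simpa using this
  · have hfj := hf j
    rw [List.getElem?_eq_none (by omega), eq_comm, List.getElem?_eq_none_iff] at hfj
    simpa using hfj

section

variable {k : ℕ}

theorem colShift_apply {π : ℕ → ℕ} (hπ : StrictMono π) (A : Fin k → ℕ → ℕ) (i : Fin k) (j : ℕ) :
    colShift π A i (π j) = A i j :=
  hπ.injective.extend_apply _ _ _

theorem colShift_of_notMem_range {π : ℕ → ℕ} (A : Fin k → ℕ → ℕ) (i : Fin k) {j : ℕ}
    (hj : j ∉ Set.range π) : colShift π A i j = 0 :=
  Function.extend_apply' _ _ _ hj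

theorem finsum_colShift {π : ℕ → ℕ} (hπ : StrictMono π) (A : Fin k → ℕ → ℕ) (i : Fin k) :
    ∑ᶠ j, colShift π A i j = ∑ᶠ j, A i j := by
  have h : ∑ᶠ j ∈ Set.range π, colShift π A i j = ∑ᶠ j, colShift π A i j := by
    refine finsum_congr fun j => ?_
    by_cases hj : j ∈ Set.range π
    · simp [hj]
    · simp [colShift_of_notMem_range A i hj]
  rw [← h, finsum_mem_range hπ.injective]
  simp only [colShift_apply hπ]

namespace IsGood

variable {A B : Fin k → ℕ → ℕ} {d e : ℕ}

theorem finite_support_row (hA : IsGood A d) (i : Fin k) : (Function.support (A i)).Finite :=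
  (hA.1.preimage (f := fun j => (i, j)) (by intro _ _ _ _ h; simpa using h)).subset
    fun _ hj => hj

theorem exists_forall_eq_zero (hA : IsGood A d) : ∃ N, ∀ j, N ≤ j → ∀ i, A i j = 0 := by
  obtain ⟨N, hN⟩ := (hA.1.image Prod.snd).bddAbove
  refine ⟨N + 1, fun j hj i => ?_⟩
  by_contra h
  have : j ≤ N := hN ⟨(i, j), h, rfl⟩
  omega

/-- The total mass `k * d` bounds the number of columns whose sum exceeds `t`. -/
theorem finite_and_card_mul_le (hA : IsGood A d) (t : ℕ) :
    {j | t < ∑ i, A i j}.Finite ∧ {j | t < ∑ i, A i j}.ncard * (t + 1) ≤ k * d := by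
  obtain ⟨N, hN⟩ := hA.exists_forall_eq_zero
  have hset : {j | t < ∑ i, A i j} = ((Finset.range N).filter fun j => t < ∑ i, A i j) := by
    ext j
    simp only [Set.mem_ofPred_eq, Finset.coe_filter, Finset.mem_range]
    refine ⟨fun h => ⟨?_, h⟩, And.right⟩
    by_contra hj
    simp [hN j (not_lt.1 hj)] at h
  refine ⟨hset ▸ Finset.finite_toSet _, ?_⟩
  rw [hset, Set.ncard_coe_finset, ← smul_eq_mul]
  calc _ ≤ ∑ j ∈ (Finset.range N).filter fun j => t < ∑ i, A i j, ∑ i, A i j :=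
        Finset.card_nsmul_le_sum _ _ _ fun j hj => (Finset.mem_filter.1 hj).2
    _ ≤ ∑ j ∈ Finset.range N, ∑ i, A i j :=
        Finset.sum_le_sum_of_subset (Finset.filter_subset _ _)
    _ = ∑ i, ∑ j ∈ Finset.range N, A i j := Finset.sum_comm
    _ = ∑ _i : Fin k, d := by
        refine Finset.sum_congr rfl fun i _ => ?_
        rw [← hA.2.1 i]
        refine (finsum_eq_sum_of_support_subset _ fun j hj => ?_).symm
        by_contra hjN
        exact hj (hN j (by simpa using hjN) i)
    _ = k * d := by simp

theorem incDiv_of_strictMono (hA : IsGood A d) (hB : IsGood B e) {π : ℕ → ℕ} (hπ : StrictMono π)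
    (hle : ∀ i j, A i j ≤ B i (π j))
    (hslack : ∀ j, d - ∑ i, A i j ≤ e - ∑ i, B i (π j))
    (hskip : ∀ j ∉ Set.range π, ∑ i, B i j ≤ e - d) : IncDiv A B := by
  have hle' : ∀ i j, colShift π A i j ≤ B i j := by
    intro i j
    by_cases hj : j ∈ Set.range π
    · obtain ⟨j, rfl⟩ := hj
      rw [colShift_apply hπ]
      exact hle i j
    · simp [colShift_of_notMem_range A i hj]
  refine ⟨π, hπ, hle', e - d, ?_, fun i => ?_, fun j => ?_⟩
  · refine hB.1.subset fun q hq => ?_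
    simp only [Set.mem_ofPred_eq] at hq ⊢
    omega
  · have hfin := hB.finite_support_row i
    have hadd := finsum_add_distrib (f := fun j => B i j - colShift π A i j)
      (g := fun j => colShift π A i j)
      (hfin.subset fun j hj => by simp only [Function.mem_support] at hj ⊢; omega)
      (hfin.subset fun j hj => by
        have := hle' i j
        simp only [Function.mem_support] at hj ⊢; omega)
    simp only [Nat.sub_add_cancel (hle' i _)] at hadd
    rw [finsum_colShift hπ, hA.2.1 i, hB.2.1 i] at hadd
    exact Nat.eq_sub_of_add_eq hadd.symm
  · by_cases hj : j ∈ Set.range π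
    · obtain ⟨j, rfl⟩ := hj
      simp only [colShift_apply hπ]
      rw [Finset.sum_tsub_distrib _ fun i _ => hle i j]
      have h₁ := hslack j
      have h₂ := hA.2.2 j
      have h₃ := hB.2.2 (π j)
      omega
    · simpa [colShift_of_notMem_range A _ hj] using hskip j hj

end IsGood

/-- A sequence of good matrices contains a divisibility if each matrix has a bounded number of
columns exceeding a threshold `t n`, and columns below the threshold may always be skipped. -/
theorem exists_incDiv_of_threshold (A : ℕ → Fin k → ℕ → ℕ) (d t : ℕ → ℕ) (K : ℕ)
    (hA : ∀ n, IsGood (A n) (d n)) (hcard : ∀ n, {j | t n < ∑ i, A n i j}.ncard ≤ K)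
    (ht : ∀ m n, m < n → d m ≤ d n → t n + d m ≤ d n) :
    ∃ m n, m < n ∧ IncDiv (A m) (A n) := by
  classical
  have isPreorder_prod_eq {α β : Type} [Preorder α] :
      IsPreorder (α × β) fun a b => a.1 ≤ b.1 ∧ a.2 = b.2 :=
    { refl := fun _ => ⟨le_rfl, rfl⟩
      trans := fun _ _ _ h₁ h₂ => ⟨h₁.1.trans h₂.1, h₁.2.trans h₂.2⟩ }
  obtain ⟨g, hg⟩ := (WellQuasiOrdered.prod (wellQuasiOrdered_le (α := ℕ))
    (Finite.wellQuasiOrdered (α := Fin (K + 1)) (· = ·))).exists_monotone_subseq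
    (fun n => (d n, ⟨_, Nat.lt_succ_of_le (hcard n)⟩))
  choose N hN using fun n => (hA n).exists_forall_eq_zero
  obtain ⟨m, n, hmn, π, hπ, hr, hout⟩ := ((WellQuasiOrdered.prod
    (wellQuasiOrdered_le (α := (Fin k → ℕ) × ℕ))
    (Finite.wellQuasiOrdered (α := Bool) (· = ·)))).exists_strictMono_word
    (fun n j => ((fun i => A (g n) i j, d (g n) - ∑ i, A (g n) i j),
      decide (t (g n) < ∑ i, A (g n) i j))) (N ∘ g)
  have hgmn := g.strictMono hmn
  obtain ⟨hd, hc⟩ := hg m n hmn.le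
  simp only [Fin.mk.injEq] at hd hc
  refine ⟨g m, g n, hgmn, ?_⟩
  have hlow : ∀ j, N (g m) ≤ j → (∀ i, A (g m) i j = 0) ∧ ∀ i, A (g n) i (π j) = 0 :=
    fun j hj => ⟨hN _ j hj, hN _ _ (hout j hj)⟩
  simp only [Prod.mk_le_mk, decide_eq_decide, Pi.le_def] at hr
  have himg : π '' {j | t (g m) < ∑ i, A (g m) i j} = {j | t (g n) < ∑ i, A (g n) i j} := by
    refine Set.eq_of_subset_of_ncard_le ?_ ?_ ((hA _).finite_and_card_mul_le _).1
    · rintro _ ⟨j, hj, rfl⟩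
      have hjN : j < N (g m) := by
        by_contra h
        simp [(hlow j (not_lt.1 h)).1] at hj
      exact (hr j hjN).2.1 hj
    · rw [Set.ncard_image_of_injective _ hπ.injective, hc]
  refine (hA _).incDiv_of_strictMono (hA _) hπ (fun i j => ?_) (fun j => ?_) fun j hj => ?_
  · obtain h | h := lt_or_ge j (N (g m))
    · exact (hr j h).1.1 i
    · simp [(hlow j h).1]
  · obtain h | h := lt_or_ge j (N (g m))
    · exact (hr j h).1.2
    · simpa [hlow j h] using hd
  · have hnot : ¬ t (g n) < ∑ i, A (g n) i j := fun h => by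
      obtain ⟨j', -, rfl⟩ := himg.ge h
      exact hj ⟨j', rfl⟩
    have := ht _ _ hgmn hd
    omega

end

/-- The Inc(ℕ)-divisibility order ≼ on the set G of good matrices in ℕ^{[k]×ℕ} is a
well-partial-order. -/
theorem goodMat_wpo (k : ℕ) (hk : 1 ≤ k)
    (f : ℕ → {A : Fin k → ℕ → ℕ // ∃ d, IsGood A d}) :
    ∃ i j : ℕ, i < j ∧ IncDiv (f i).1 (f j).1 := by
  choose d hd using fun n => (f n).2
  have : IsTrans ℕ fun a b => 2 * a ≤ b := ⟨fun a b c h₁ h₂ => by omega⟩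
  suffices ∃ g : ℕ ↪o ℕ, ∃ m n, m < n ∧ IncDiv (f (g m)).1 (f (g n)).1 by
    obtain ⟨g, m, n, hmn, h⟩ := this
    exact ⟨g m, g n, g.strictMono hmn, h⟩
  obtain ⟨g, hg | hg⟩ := exists_increasing_or_nonincreasing_subseq (fun a b : ℕ => 2 * a ≤ b) d
  · refine ⟨g, exists_incDiv_of_threshold (fun n => (f (g n)).1) (fun n => d (g n))
      (fun n => d (g n) / 2) (2 * k) (fun n => hd _) (fun n => ?_) fun m n hmn _ => ?_⟩
    · have h := ((hd (g n)).finite_and_card_mul_le (d (g n) / 2)).2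
      refine Nat.le_of_mul_le_mul_right (h.trans ?_) (Nat.succ_pos (d (g n) / 2))
      rw [mul_comm 2 k, mul_assoc]
      exact Nat.mul_le_mul_left k (by omega)
    · have := hg m n hmn
      omega
  · refine ⟨g, exists_incDiv_of_threshold (fun n => (f (g n)).1) (fun n => d (g n))
      (fun _ => 0) (k * (2 * d (g 0))) (fun n => hd _) (fun n => ?_) fun m n _ h => by simpa using h⟩
    have h := ((hd (g n)).finite_and_card_mul_le 0).2
    rw [zero_add, mul_one] at h
    refine h.trans (Nat.mul_le_mul_left k ?_)
    obtain rfl | hn := Nat.eq_zero_or_pos n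
    · omega
    · have := hg 0 n hn
      omega
end

section
/- Fix N ≥ 1 and integers k_p ≥ 1 for p ∈ [N]. For every t ∈ ℕ, the partially ordered set (𝓜_t, ≼) of elements of 𝓜 with exactly t bad indices is a well-partial-order. -/
/-- An element of the set 𝓜 (multi version): a common length `len`, for each `p ∈ [N]` a
matrix `A p` with `k p + 1` rows and `len` columns, and a multi-degree `d`, such that for
every `p` each column sum of `A p` equals `d p` and each of the first `k p` row sums of
`A p` is at most `d p`. -/
structure MatMN (N : ℕ) (k : Fin N → ℕ) where
  len : ℕ
  A : ∀ p : Fin N, Fin (k p + 1) → Fin len → ℕ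
  d : Fin N → ℕ
  colsum : ∀ p j, ∑ i, A p i j = d p
  rowsum : ∀ p (i : Fin (k p)), ∑ j, A p i.castSucc j ≤ d p

/-- The partial order ≼ on 𝓜: `X ≼ Y` iff `d_{X,p} ≤ d_{Y,p}` for all `p` and there is a
strictly increasing map `ρ` of column indices with `ρX_p ≤ Y_p` entrywise for every `p`,
where `ρX_p` has column `(X_p)_{·,j}` at position `ρ(j)` and the trivial column
`(0,…,0,d_{X,p})ᵀ` at positions outside the image of `ρ`. -/
def MatMN.pre {N : ℕ} {k : Fin N → ℕ} (X Y : MatMN N k) : Prop :=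
  (∀ p, X.d p ≤ Y.d p) ∧ ∃ ρ : Fin X.len → Fin Y.len, StrictMono ρ ∧
    (∀ p i j, X.A p i j ≤ Y.A p i (ρ j)) ∧
    (∀ j : Fin Y.len, (∀ j', ρ j' ≠ j) → ∀ p, X.d p ≤ Y.A p (Fin.last (k p)) j)

/-- The number of bad indices of `X`: an index `j` is bad if `2·(X_p)_{k_p,j} ≤ d_{X,p}`
for some `p ∈ [N]`. -/
noncomputable def MatMN.badCard {N : ℕ} {k : Fin N → ℕ} (X : MatMN N k) : ℕ :=
  (Finset.univ.filter fun j : Fin X.len =>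
    ∃ p, 2 * X.A p (Fin.last (k p)) j ≤ X.d p).card

open Filter in
/-- Along an ultrafilter, a sequence of naturals is either eventually constant or tends to
infinity. -/
theorem Ultrafilter.eventually_eq_or_tendsto_atTop {α : Type*} (U : Ultrafilter α) (g : α → ℕ) :
    (∃ c, ∀ᶠ n in U, g n = c) ∨ Tendsto g U atTop := by
  rw [tendsto_atTop, or_iff_not_imp_right]
  intro h
  push Not at h
  obtain ⟨b, hb⟩ := h
  have hlt : ∀ᶠ n in U, ∃ c ∈ Set.Iio b, g n = c := by
    simpa using hb
  obtain ⟨c, -, hc⟩ := (U.eventually_exists_mem_iff (Set.finite_Iio b)).1 hlt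
  exact ⟨c, hc⟩

/-- Higman's lemma for words indexed by `Fin`. -/
theorem WellQuasiOrdered.exists_strictMono_fin {α : Type*} {r : α → α → Prop} [IsPreorder α r]
    (h : WellQuasiOrdered r) (n : ℕ → ℕ) (w : ∀ i, Fin (n i) → α) :
    ∃ i j, i < j ∧ ∃ ρ : Fin (n i) → Fin (n j), StrictMono ρ ∧ ∀ x, r (w i x) (w j (ρ x)) := by
  obtain ⟨i, j, hij, hr⟩ := Set.PartiallyWellOrderedOn.partiallyWellOrderedOn_sublistForall₂ r
    (Set.partiallyWellOrderedOn_univ_iff.2 h)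
    (fun i => ⟨List.ofFn (w i), fun _ _ => Set.mem_univ _⟩)
  refine ⟨i, j, hij, ?_⟩
  obtain ⟨l, hl, hsub⟩ := List.sublistForall₂_iff.1 hr
  obtain ⟨e, he⟩ := List.sublist_iff_exists_fin_orderEmbedding_get_eq.1 hsub
  obtain ⟨hlen, hget⟩ := List.forall₂_iff_get.1 hl
  have hni : n i = l.length := by simpa using hlen
  have hnj : (List.ofFn (w j)).length = n j := by simp
  refine ⟨fun x => (e (x.cast hni)).cast hnj, fun x y hxy => ?_, fun x => ?_⟩
  · have : x.cast hni < y.cast hni := hxy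
    exact e.strictMono this
  · have hx := hget x (by simp) (hni ▸ x.2)
    have hex := he (x.cast hni)
    simp only [List.get_eq_getElem, List.getElem_ofFn, Fin.val_cast] at hx hex
    rwa [hex] at hx

/-- An injection preserving and reflecting predicates with equally many solutions is surjective
on solutions. -/
theorem Function.Injective.exists_eq_of_card_filter_eq {α β : Type*} [Fintype α] [Fintype β]
    {P : α → Prop} {Q : β → Prop} [DecidablePred P] [DecidablePred Q] {ρ : α → β}
    (hρ : Function.Injective ρ) (hPQ : ∀ x, P x → Q (ρ x))
    (hcard : (Finset.univ.filter P).card = (Finset.univ.filter Q).card) {y : β} (hy : Q y) :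
    ∃ x, ρ x = y := by
  classical
  have hsub : (Finset.univ.filter P).image ρ ⊆ Finset.univ.filter Q := by
    intro z hz
    obtain ⟨x, hx, rfl⟩ := Finset.mem_image.1 hz
    simpa using hPQ x (by simpa using hx)
  have heq := Finset.eq_of_subset_of_card_le hsub (by
    rw [Finset.card_image_of_injective _ hρ, hcard])
  have hmem : y ∈ (Finset.univ.filter P).image ρ := by rw [heq]; simpa using hy
  obtain ⟨x, -, hx⟩ := Finset.mem_image.1 hmem
  exact ⟨x, hx⟩

namespace MatMN

variable {N : ℕ} {k : Fin N → ℕ}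

/-- An index is special relative to a set `C` of components if it is bad or its column is
nontrivial for some `p ∈ C`. -/
def IsSpecial (C : Finset (Fin N)) (X : MatMN N k) (j : Fin X.len) : Prop :=
  (∃ p, 2 * X.A p (Fin.last (k p)) j ≤ X.d p) ∨ ∃ p ∈ C, X.A p (Fin.last (k p)) j ≠ X.d p

theorem card_nontrivial_le (X : MatMN N k) (p : Fin N) :
    (Finset.univ.filter fun j => X.A p (Fin.last (k p)) j ≠ X.d p).card ≤ k p * X.d p := by
  calc (Finset.univ.filter fun j => X.A p (Fin.last (k p)) j ≠ X.d p).card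
      = ∑ j, if X.A p (Fin.last (k p)) j ≠ X.d p then 1 else 0 := Finset.card_filter _ _
    _ ≤ ∑ j, ∑ i : Fin (k p), X.A p i.castSucc j := by
        refine Finset.sum_le_sum fun j _ => ?_
        have := X.colsum p j
        rw [Fin.sum_univ_castSucc] at this
        split_ifs <;> omega
    _ = ∑ i : Fin (k p), ∑ j, X.A p i.castSucc j := Finset.sum_comm
    _ ≤ ∑ _i : Fin (k p), X.d p := Finset.sum_le_sum fun i _ => X.rowsum p i
    _ = k p * X.d p := by simp

open Classical in
theorem card_isSpecial_le (C : Finset (Fin N)) (X : MatMN N k) :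
    (Finset.univ.filter (X.IsSpecial C)).card ≤ X.badCard + ∑ p ∈ C, k p * X.d p := by
  have hsub : Finset.univ.filter (X.IsSpecial C) ⊆
      (Finset.univ.filter fun j => ∃ p, 2 * X.A p (Fin.last (k p)) j ≤ X.d p) ∪
        C.biUnion fun p => Finset.univ.filter fun j => X.A p (Fin.last (k p)) j ≠ X.d p := by
    intro j hj
    simpa [IsSpecial] using hj
  refine (Finset.card_le_card hsub).trans ((Finset.card_union_le _ _).trans ?_)
  refine add_le_add (le_of_eq ?_) (Finset.card_biUnion_le.trans
    (Finset.sum_le_sum fun p _ => X.card_nontrivial_le p))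
  unfold badCard
  congr

open Classical in
/-- A column-dominating embedding that matches special columns is a witness for `≼`, when the
degrees agree on `C` and at least double off `C`. -/
theorem pre_of_isSpecial_imp {C : Finset (Fin N)} {X Y : MatMN N k}
    (hC : ∀ p ∈ C, X.d p = Y.d p) (hd : ∀ p ∉ C, 2 * X.d p ≤ Y.d p)
    (hcard : (Finset.univ.filter (X.IsSpecial C)).card =
      (Finset.univ.filter (Y.IsSpecial C)).card)
    {ρ : Fin X.len → Fin Y.len} (hρ : StrictMono ρ)
    (hspec : ∀ j, X.IsSpecial C j → Y.IsSpecial C (ρ j))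
    (hA : ∀ p i j, X.A p i j ≤ Y.A p i (ρ j)) : X.pre Y := by
  refine ⟨fun p => ?_, ρ, hρ, hA, fun j hj p => ?_⟩
  · by_cases hp : p ∈ C
    · exact (hC p hp).le
    · have := hd p hp
      omega
  · have hns : ¬ Y.IsSpecial C j := fun h =>
      let ⟨x, hx⟩ := hρ.injective.exists_eq_of_card_filter_eq hspec hcard h
      hj x hx
    simp only [IsSpecial, not_or, not_exists, not_and, not_not] at hns
    by_cases hp : p ∈ C
    · exact (hC p hp).trans_le (hns.2 p hp).ge
    · have h₁ := hns.1 p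
      have h₂ := hd p hp
      omega

open Filter Classical in
/-- Every sequence with a bounded number of bad indices has a subsequence along which some
degrees are constant, the remaining ones at least double at each step, and the number of special
indices is constant. -/
theorem exists_subseq (f : ℕ → MatMN N k) (t : ℕ) (ht : ∀ n, (f n).badCard ≤ t) :
    ∃ (C : Finset (Fin N)) (s : ℕ) (g : ℕ → ℕ), StrictMono g ∧
      (∀ n, (Finset.univ.filter ((f (g n)).IsSpecial C)).card = s) ∧
      (∀ m n, ∀ p ∈ C, (f (g m)).d p = (f (g n)).d p) ∧
      ∀ m n, m < n → ∀ p ∉ C, 2 * (f (g m)).d p ≤ (f (g n)).d p := by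
  set U := hyperfilter ℕ
  set C : Finset (Fin N) := Finset.univ.filter fun p => ∃ c, ∀ᶠ n in U, (f n).d p = c with hCdef
  have hC : ∀ p, ∃ c, p ∈ C → ∀ᶠ n in U, (f n).d p = c := by
    intro p
    by_cases hp : p ∈ C
    · obtain ⟨c, hc⟩ := (Finset.mem_filter.1 hp).2
      exact ⟨c, fun _ => hc⟩
    · exact ⟨0, fun h => absurd h hp⟩
  choose c hc using hC
  have hconst : ∀ᶠ n in U, ∀ p ∈ C, (f n).d p = c p :=
    (Filter.eventually_all_finset C).2 hc
  have hgrow : ∀ p ∉ C, Tendsto (fun n => (f n).d p) U atTop := fun p hp =>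
    (U.eventually_eq_or_tendsto_atTop _).resolve_left fun h => hp (by simpa [hCdef] using h)
  obtain ⟨s, hs⟩ : ∃ s, ∀ᶠ n in U, (Finset.univ.filter ((f n).IsSpecial C)).card = s := by
    refine (U.eventually_eq_or_tendsto_atTop _).resolve_right fun h => ?_
    obtain ⟨n, hn, hlt⟩ :=
      (hconst.and (h.eventually_gt_atTop (t + ∑ p ∈ C, k p * c p))).exists
    have hle := (f n).card_isSpecial_le C
    rw [Finset.sum_congr rfl fun p hp => by rw [hn p hp]] at hle
    have := ht n
    omega
  obtain ⟨g, hg, hgr⟩ := exists_seq_of_forall_finset_exists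
    (fun n => (∀ p ∈ C, (f n).d p = c p) ∧ (Finset.univ.filter ((f n).IsSpecial C)).card = s)
    (fun m n => m < n ∧ ∀ p ∉ C, 2 * (f m).d p ≤ (f n).d p) (by
      intro S _
      refine ((hconst.and hs).and ((Filter.eventually_all_finset S).2 fun m _ => ?_)).exists
      refine ((eventually_gt_atTop m).filter_mono Nat.hyperfilter_le_atTop).and ?_
      exact eventually_all.2 fun p => by
        by_cases hp : p ∈ C
        · exact .of_forall fun _ h => absurd hp h
        · exact ((hgrow p hp).eventually_ge_atTop _).mono fun _ h _ => h)
  exact ⟨C, s, g, fun m n h => (hgr m n h).1, fun n => (hg n).2,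
    fun m n p hp => ((hg m).1 p hp).trans ((hg n).1 p hp).symm, fun m n h => (hgr m n h).2⟩

end MatMN

/-- For every t ∈ ℕ, (𝓜ₜ, ≼), the set of elements of 𝓜 with exactly t bad indices,
is a well-partial-order. -/
theorem matMNt_wpo (N : ℕ) (hN : 1 ≤ N) (k : Fin N → ℕ) (hk : ∀ p, 1 ≤ k p) (t : ℕ)
    (f : ℕ → {X : MatMN N k // X.badCard = t}) :
    ∃ i j : ℕ, i < j ∧ MatMN.pre (f i).1 (f j).1 := by
  obtain ⟨C, s, g, hg, hs, hC, hd⟩ :=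
    MatMN.exists_subseq (fun n => (f n).1) t fun n => (f n).2.le
  have hwqo := (Finite.wellQuasiOrdered (α := Prop) (· = ·)).prod
    (wellQuasiOrdered_le (α := ∀ p : Fin N, Fin (k p + 1) → ℕ))
  have : IsPreorder (Prop × (∀ p : Fin N, Fin (k p + 1) → ℕ))
      (fun a b => a.1 = b.1 ∧ a.2 ≤ b.2) :=
    { refl := fun _ => ⟨rfl, le_rfl⟩
      trans := fun _ _ _ h₁ h₂ => ⟨h₁.1.trans h₂.1, h₁.2.trans h₂.2⟩ }
  obtain ⟨m, n, hmn, ρ, hρ, hr⟩ := hwqo.exists_strictMono_fin (fun i => (f (g i)).1.len)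
    (fun i j => ((f (g i)).1.IsSpecial C j, fun p i' => (f (g i)).1.A p i' j))
  exact ⟨g m, g n, hg hmn, MatMN.pre_of_isSpecial_imp (hC m n) (hd m n hmn)
    ((hs m).trans (hs n).symm) hρ (fun j => (hr j).1.mp) fun p i j => (hr j).2 p i⟩
end

section
/- Fix N ≥ 1 and integers k_p ≥ 1 for p ∈ [N]. The partially ordered set (𝓜, ≼) is a well-partial-order. -/
/-- A sublist relation up to `r` between two finite families, read as a strictly increasing map. -/
theorem List.SublistForall₂.exists_strictMono {β : Type*} {r : β → β → Prop} {m n : ℕ}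
    {a : Fin m → β} {b : Fin n → β} (h : List.SublistForall₂ r (List.ofFn a) (List.ofFn b)) :
    ∃ ρ : Fin m → Fin n, StrictMono ρ ∧ ∀ j, r (a j) (b (ρ j)) := by
  obtain ⟨l, hl, hs⟩ := List.sublistForall₂_iff.1 h
  obtain ⟨e, he⟩ := List.sublist_iff_exists_fin_orderEmbedding_get_eq.1 hs
  obtain ⟨hlen, hr⟩ := List.forall₂_iff_get.1 hl
  have hm : m = l.length := by simpa using hlen
  refine ⟨fun j => Fin.cast (by simp) (e (Fin.cast hm j)), fun i j hij => ?_, fun j => ?_⟩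
  · exact e.strictMono (a := Fin.cast hm i) (b := Fin.cast hm j) hij
  · have h₁ := hr j (by simp) (hm ▸ j.2)
    have h₂ := he (Fin.cast hm j)
    simp only [List.get_eq_getElem, List.getElem_ofFn, Fin.val_cast, Fin.eta] at h₁ h₂
    rw [h₂] at h₁
    exact h₁

/-- Higman's lemma for finite families whose members carry a flag that must be preserved. -/
theorem wellQuasiOrdered_flagged_families (α : Type*) [Preorder α] [WellQuasiOrderedLE α] :
    WellQuasiOrdered fun x y : Σ n, Fin n → Prop × α =>
      ∃ ρ : Fin x.1 → Fin y.1, StrictMono ρ ∧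
        ∀ j, (x.2 j).1 = (y.2 (ρ j)).1 ∧ (x.2 j).2 ≤ (y.2 (ρ j)).2 := by
  let r : Prop × α → Prop × α → Prop := fun a b => a.1 = b.1 ∧ a.2 ≤ b.2
  have : IsPreorder (Prop × α) r :=
    { refl := fun a => ⟨rfl, le_rfl⟩
      trans := fun a b c hab hbc => ⟨hab.1.trans hbc.1, hab.2.trans hbc.2⟩ }
  have hr : WellQuasiOrdered r :=
    (Finite.wellQuasiOrdered (α := Prop) (· = ·)).prod (wellQuasiOrdered_le (α := α))
  have hlist : WellQuasiOrdered (List.SublistForall₂ r) := by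
    have h := Set.PartiallyWellOrderedOn.partiallyWellOrderedOn_sublistForall₂ r
      (Set.partiallyWellOrderedOn_univ_iff.2 hr)
    simpa [Set.partiallyWellOrderedOn_univ_iff] using h
  intro f
  obtain ⟨m, n, hmn, h⟩ := hlist fun i => List.ofFn (f i).2
  exact ⟨m, n, hmn, h.exists_strictMono⟩

namespace MatMN

variable {N : ℕ} {k : Fin N → ℕ}

theorem sum_castSucc_add_last (X : MatMN N k) (p : Fin N) (j : Fin X.len) :
    ∑ i : Fin (k p), X.A p i.castSucc j + X.A p (Fin.last (k p)) j = X.d p := by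
  rw [← X.colsum p j, Fin.sum_univ_castSucc]

theorem sum_sum_castSucc_le (X : MatMN N k) (p : Fin N) :
    ∑ j, ∑ i : Fin (k p), X.A p i.castSucc j ≤ k p * X.d p := by
  rw [Finset.sum_comm]
  simpa using Finset.sum_le_card_nsmul Finset.univ _ _ fun i _ => X.rowsum p i

/-- If every column in `s` has weight at least `c` above the last row, then `s` is small. -/
theorem card_mul_le (X : MatMN N k) (p : Fin N) (s : Finset (Fin X.len)) (c : ℕ)
    (h : ∀ j ∈ s, c ≤ 2 * ∑ i : Fin (k p), X.A p i.castSucc j) :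
    s.card * c ≤ 2 * (k p * X.d p) :=
  calc s.card * c ≤ ∑ j ∈ s, 2 * ∑ i : Fin (k p), X.A p i.castSucc j := by
        simpa using Finset.card_nsmul_le_sum s _ c h
    _ ≤ ∑ j, 2 * ∑ i : Fin (k p), X.A p i.castSucc j :=
        Finset.sum_le_sum_of_subset (Finset.subset_univ s)
    _ ≤ 2 * (k p * X.d p) := by
        rw [← Finset.mul_sum]
        exact Nat.mul_le_mul_left 2 (X.sum_sum_castSucc_le p)

/-- The last entry of column `j` of `X.A p` is less than `X.d p / 2` if `p ∈ S`, and less than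
`X.d p` otherwise. -/
def HeavyAt (S : Set (Fin N)) (X : MatMN N k) (p : Fin N) (j : Fin X.len) : Prop :=
  (p ∈ S ∧ 2 * X.A p (Fin.last (k p)) j < X.d p) ∨
    (p ∉ S ∧ X.A p (Fin.last (k p)) j < X.d p)

open Classical in
/-- The columns that are heavy for some `p`. -/
noncomputable def heavy (S : Set (Fin N)) (X : MatMN N k) : Finset (Fin X.len) :=
  {j | ∃ p, X.HeavyAt S p j}

theorem mem_heavy {S : Set (Fin N)} {X : MatMN N k} {j : Fin X.len} :
    j ∈ X.heavy S ↔ ∃ p, X.HeavyAt S p j := by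
  simp [heavy]

open Classical in
theorem card_heavyAt_le (S : Set (Fin N)) (X : MatMN N k) (p : Fin N) (C : ℕ)
    (hC : p ∉ S → X.d p ≤ C) :
    (Finset.univ.filter fun j => X.HeavyAt S p j).card ≤ 2 * k p * (C + 1) := by
  set s := Finset.univ.filter fun j => X.HeavyAt S p j with hs
  by_cases hp : p ∈ S
  · have h := X.card_mul_le p s (X.d p + 1) fun j hj => by
      have h₁ : X.HeavyAt S p j := by simpa [hs] using hj
      have h₂ := X.sum_castSucc_add_last p j
      simp only [HeavyAt, hp, true_and, not_true, false_and, or_false] at h₁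
      omega
    have : s.card ≤ 2 * k p := by
      refine Nat.le_of_mul_le_mul_right (h.trans ?_) (Nat.succ_pos (X.d p))
      rw [← mul_assoc]
      exact Nat.mul_le_mul_left _ (Nat.le_succ _)
    exact this.trans (Nat.le_mul_of_pos_right _ C.succ_pos)
  · have h := X.card_mul_le p s 1 fun j hj => by
      have h₁ : X.HeavyAt S p j := by simpa [hs] using hj
      have h₂ := X.sum_castSucc_add_last p j
      simp only [HeavyAt, hp, false_and, not_false_eq_true, true_and, false_or] at h₁
      omega
    rw [mul_one, ← mul_assoc] at h
    exact h.trans (Nat.mul_le_mul_left _ ((hC hp).trans C.le_succ))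

theorem card_heavy_le (S : Set (Fin N)) (X : MatMN N k) (C : ℕ) (hC : ∀ p ∉ S, X.d p ≤ C) :
    (X.heavy S).card ≤ ∑ p, 2 * k p * (C + 1) := by
  classical
  have : X.heavy S = Finset.univ.biUnion fun p => Finset.univ.filter fun j => X.HeavyAt S p j := by
    ext j
    simp [mem_heavy]
  rw [this]
  exact Finset.card_biUnion_le.trans
    (Finset.sum_le_sum fun p _ => X.card_heavyAt_le S p C (hC p))

/-- An embedding of columns that matches heavy columns with heavy columns, between matrices with
equally many of them, skips no heavy column. -/
theorem pre_of_embedding (S : Set (Fin N)) {X Y : MatMN N k} (hd : ∀ p, X.d p ≤ Y.d p)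
    (hS : ∀ p ∈ S, 2 * X.d p ≤ Y.d p) (hcard : (X.heavy S).card = (Y.heavy S).card)
    (ρ : Fin X.len → Fin Y.len) (hρ : StrictMono ρ)
    (hheavy : ∀ j, j ∈ X.heavy S ↔ ρ j ∈ Y.heavy S)
    (hle : ∀ p i j, X.A p i j ≤ Y.A p i (ρ j)) : X.pre Y := by
  refine ⟨hd, ρ, hρ, hle, fun j hj p => ?_⟩
  have himage : (X.heavy S).image ρ = Y.heavy S := by
    refine Finset.eq_of_subset_of_card_le ?_ ?_
    · intro x hx
      obtain ⟨y, hy, rfl⟩ := Finset.mem_image.1 hx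
      exact (hheavy y).1 hy
    · rw [Finset.card_image_of_injective _ hρ.injective, hcard]
  have hlight : ¬ Y.HeavyAt S p j := fun h => by
    have hmem := mem_heavy.2 ⟨p, h⟩
    rw [← himage] at hmem
    obtain ⟨y, -, hy⟩ := Finset.mem_image.1 hmem
    exact hj y hy
  by_cases hp : p ∈ S
  · have := hS p hp
    simp only [HeavyAt, hp, true_and, not_true, false_and, or_false] at hlight
    omega
  · have := hd p
    simp only [HeavyAt, hp, false_and, not_false_eq_true, true_and, false_or] at hlight
    omega

end MatMN

/-- A sequence of natural vectors has a subsequence along which some coordinates at least double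
at each step, while the others are bounded, and all are monotone. -/
theorem exists_subseq_doubling_or_bounded {ι : Type*} [Finite ι] (d : ℕ → ι → ℕ) :
    ∃ (S : Set ι) (C : ℕ) (g : ℕ → ℕ), StrictMono g ∧ (∀ n, ∀ p ∉ S, d (g n) p ≤ C) ∧
      ∀ m n, m < n → (∀ p, d (g m) p ≤ d (g n) p) ∧ ∀ p ∈ S, 2 * d (g m) p ≤ d (g n) p := by
  obtain ⟨e, he⟩ := (wellQuasiOrdered_le (α := ι → ℕ)).exists_monotone_subseq d
  let S : Set ι := {p | ∀ B, ∃ n, B ≤ d (e n) p}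
  have hbdd : ∃ C, ∀ n, ∀ p ∉ S, d (e n) p ≤ C := by
    have h : ∀ p, ∃ B, p ∉ S → ∀ n, d (e n) p ≤ B := fun p => by
      by_cases hp : p ∈ S
      · exact ⟨0, fun h => absurd hp h⟩
      · simp only [S, Set.mem_ofPred_eq, not_forall, not_exists, not_le] at hp
        obtain ⟨B, hB⟩ := hp
        exact ⟨B, fun _ n => (hB n).le⟩
    choose B hB using h
    obtain ⟨C, hC⟩ := (Set.finite_range B).bddAbove
    exact ⟨C, fun n p hp => (hB p hp n).trans (hC ⟨p, rfl⟩)⟩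
  obtain ⟨C, hC⟩ := hbdd
  have hdouble : ∀ m, ∀ᶠ n in Filter.atTop, m < n ∧ ∀ p ∈ S, 2 * d (e m) p ≤ d (e n) p := by
    intro m
    refine (Filter.eventually_gt_atTop m).and (Filter.eventually_all.2 fun p => ?_)
    by_cases hp : p ∈ S
    · obtain ⟨M, hM⟩ := hp (2 * d (e m) p)
      filter_upwards [Filter.eventually_ge_atTop M] with n hn _
      exact hM.trans (he M n hn p)
    · exact Filter.Eventually.of_forall fun _ h => absurd h hp
  obtain ⟨h, -, hh⟩ := exists_seq_of_forall_finset_exists (fun _ : ℕ => True)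
    (fun m n => m < n ∧ ∀ p ∈ S, 2 * d (e m) p ≤ d (e n) p) fun s _ => by
      obtain ⟨y, hy⟩ := ((Filter.eventually_all_finset s).2 fun m _ => hdouble m).exists
      exact ⟨y, trivial, hy⟩
  refine ⟨S, C, e ∘ h, e.strictMono.comp fun m n hmn => (hh m n hmn).1, fun n => hC (h n),
    fun m n hmn => ⟨he _ _ (hh m n hmn).1.le, (hh m n hmn).2⟩⟩

/-- (𝓜, ≼) is a well-partial-order. -/
theorem matMN_wpo (N : ℕ) (hN : 1 ≤ N) (k : Fin N → ℕ) (hk : ∀ p, 1 ≤ k p)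
    (f : ℕ → MatMN N k) :
    ∃ i j : ℕ, i < j ∧ MatMN.pre (f i) (f j) := by
  obtain ⟨S, C, g, hg, hC, hd⟩ := exists_subseq_doubling_or_bounded fun n => (f n).d
  have hcount (n : ℕ) := (f (g n)).card_heavy_le S C (hC n)
  obtain ⟨i, j, hij, hcard, ρ, hρ, hcol⟩ :=
    (Finite.wellQuasiOrdered (α := Fin (∑ p, 2 * k p * (C + 1) + 1)) (· = ·)).prod
      (wellQuasiOrdered_flagged_families (∀ p : Fin N, Fin (k p + 1) → ℕ)) fun n =>
        (⟨((f (g n)).heavy S).card, Nat.lt_succ_of_le (hcount n)⟩,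
          ⟨(f (g n)).len, fun j => (j ∈ (f (g n)).heavy S, fun p i => (f (g n)).A p i j)⟩)
  exact ⟨g i, g j, hg hij, MatMN.pre_of_embedding S (hd i j hij).1 (hd i j hij).2
    (Fin.mk.inj hcard) ρ hρ (fun x => iff_of_eq (hcol x).1) fun p y x => (hcol x).2 p y⟩
end
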